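/- (Moment-polynomial step in the proof of Proposition 5.2) Let 𝒪 ⊆ ℝ⁴ be open and convex with V₊ ⊆ 𝒪, let B ⊆ V₊ be compact, and let (ρ_x)_{x∈𝒪} be a family of Borel probability measures on ℝ⁴ with supp ρ_x ⊆ B for all x. Assume: (i) for every positive lightlike p, the function F_p(x) := ∫ e^{i β·p} dρ_x(β) is smooth on 𝒪 and satisfies Σ_ν pᵥ ∂_ν F_p(x) = 0 and □F_p(x) = 0 on 𝒪; (ii) for every unit vector 𝐞 ∈ ℝ³ and every m ∈ ℕ, the function x ↦ ∫ (e·β)^m dρ_x(β), with e = (1, 𝐞), is smooth on 𝒪. Then for every unit vector 𝐞 ∈ ℝ³ and every m ∈ ℕ there exists a real polynomial Q of degree at most m such that ∫ (e·β)^m dρ_x(β) = Q(e·x) for all x ∈ 𝒪. -/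

import Mathlib

open MeasureTheory

noncomputable section

/-- Minkowski inner product on ℝ⁴: x·y = x₀y₀ − x₁y₁ − x₂y₂ − x₃y₃. -/
def mink (x y : Fin 4 → ℝ) : ℝ := x 0 * y 0 - x 1 * y 1 - x 2 * y 2 - x 3 * y 3

/-- Partial derivative in the ν-th coordinate direction. -/
def pd {E : Type*} [NormedAddCommGroup E] [NormedSpace ℝ E]
    (ν : Fin 4) (f : (Fin 4 → ℝ) → E) (x : Fin 4 → ℝ) : E :=
  fderiv ℝ f x (Pi.single ν 1)

/-- The d'Alembertian □ = ∂₀² − ∂₁² − ∂₂² − ∂₃². -/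
def box {E : Type*} [NormedAddCommGroup E] [NormedSpace ℝ E]
    (f : (Fin 4 → ℝ) → E) (x : Fin 4 → ℝ) : E :=
  pd 0 (pd 0 f) x - pd 1 (pd 1 f) x - pd 2 (pd 2 f) x - pd 3 (pd 3 f) x

/-- The open forward light cone V₊ = {x : x₀ > 0, x·x > 0}. -/
def Vplus : Set (Fin 4 → ℝ) := {x | 0 < x 0 ∧ 0 < mink x x}

/-- A vector p is positive lightlike if p ≠ 0, p·p = 0 and p₀ > 0. -/
def PosLightlike (p : Fin 4 → ℝ) : Prop := p ≠ 0 ∧ mink p p = 0 ∧ 0 < p 0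

/-- The positive lightlike vector e = (1, 𝐞) associated with a unit vector
𝐞 ∈ ℝ³. -/
def lightOne (e : EuclideanSpace ℝ (Fin 3)) : Fin 4 → ℝ :=
  Fin.cons 1 (fun i => e i)

theorem mink_cons_cons (s t : ℝ) (v w : Fin 3 → ℝ) :
    mink (Fin.cons s v) (Fin.cons t w) = s * t - v 0 * w 0 - v 1 * w 1 - v 2 * w 2 :=
  rfl

theorem iteratedDeriv_comp_mul_left_apply {E : Type*} [NormedAddCommGroup E] [NormedSpace ℝ E]
    (n : ℕ) (f : ℝ → E) (c x : ℝ) :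
    iteratedDeriv n (fun s => f (c * s)) x = c ^ n • iteratedDeriv n f (c * x) := by
  induction n generalizing x with
  | zero => simp
  | succ n ih =>
    rw [iteratedDeriv_succ, iteratedDeriv_succ, funext ih, deriv_fun_const_smul_field,
      deriv_comp_mul_left c (iteratedDeriv n f) x, smul_smul, pow_succ]

theorem exists_polynomial_of_iteratedDeriv_eq_zero {I : Set ℝ} (hI : IsOpen I)
    (hIc : IsPreconnected I) {h : ℝ → ℝ} (hh : ContDiffOn ℝ (⊤ : ℕ∞) h I) {m : ℕ}
    (hz : ∀ u ∈ I, iteratedDeriv (m + 1) h u = 0) :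
    ∃ Q : Polynomial ℝ, Q.natDegree ≤ m ∧ ∀ u ∈ I, h u = Q.eval u := by
  rcases I.eq_empty_or_nonempty with rfl | ⟨u₀, hu₀⟩
  · exact ⟨0, by simp, by simp⟩
  refine ⟨∑ k ∈ Finset.range (m + 1), Polynomial.C ((k.factorial : ℝ)⁻¹ *
    iteratedDerivWithin k h I u₀) * (Polynomial.X - Polynomial.C u₀) ^ k, ?_, ?_⟩
  · refine Polynomial.natDegree_sum_le_of_forall_le _ _ fun k hk => ?_
    refine (Polynomial.natDegree_C_mul_le _ _).trans ?_
    rw [Polynomial.natDegree_pow, Polynomial.natDegree_X_sub_C]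
    have := Finset.mem_range.1 hk
    omega
  · intro u hu
    have hder : ∀ y ∈ I, HasDerivAt (fun t => taylorWithinEval h m I t u) 0 y := by
      intro y hy
      have h1 := hasDerivWithinAt_taylorWithinEval (x := u) hI.uniqueDiffOn
        (self_mem_nhdsWithin : I ∈ nhdsWithin y I) hy subset_rfl
        (hh.of_le (by exact_mod_cast le_top) : ContDiffOn ℝ m h I)
        ((hh.differentiableOn_iteratedDerivWithin (by exact_mod_cast WithTop.coe_lt_top m)
          hI.uniqueDiffOn) y hy)
      rw [iteratedDerivWithin_of_isOpen hI hy, hz y hy, smul_zero] at h1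
      exact h1.hasDerivAt (hI.mem_nhds hy)
    have hc : taylorWithinEval h m I u u = taylorWithinEval h m I u₀ u :=
      hI.is_const_of_deriv_eq_zero hIc
        (fun y hy => (hder y hy).differentiableAt.differentiableWithinAt)
        (fun y hy => (hder y hy).deriv) hu hu₀
    rw [taylorWithinEval_self, taylor_within_apply] at hc
    rw [hc, Polynomial.eval_finsetSum]
    refine Finset.sum_congr rfl fun k _ => ?_
    simp
    ring

theorem add_mem_of_mem_Vplus {O : Set (Fin 4 → ℝ)} (hO : IsOpen O) (hc : Convex ℝ O)
    (hV : Vplus ⊆ O) {x v : Fin 4 → ℝ} (hx : x ∈ O) (hv : v ∈ Vplus) : x + v ∈ O := by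
  have hcont : ContinuousAt (fun r : ℝ => (1 - r)⁻¹ • x) 0 := by
    have : ContinuousAt (fun r : ℝ => (1 - r)⁻¹) 0 :=
      ContinuousAt.inv₀ (by fun_prop) (by norm_num)
    fun_prop
  have hev : ∀ᶠ r : ℝ in nhds 0, (1 - r)⁻¹ • x ∈ O :=
    hcont.eventually_mem (by simpa using hO.mem_nhds hx)
  obtain ⟨δ, hδ, hball⟩ := Metric.eventually_nhds_iff.1 hev
  obtain ⟨r, hr0, hr⟩ := exists_between (lt_min hδ one_pos)
  have hr1 : r < 1 := hr.trans_le (min_le_right _ _)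
  have h1 : (1 - r)⁻¹ • x ∈ O :=
    hball (by rw [Real.dist_eq, sub_zero, abs_of_pos hr0]; exact hr.trans_le (min_le_left _ _))
  have h2 : r⁻¹ • v ∈ O := by
    apply hV
    have hv' : 0 < v 0 ∧ 0 < mink v v := hv
    refine Set.mem_ofPred_eq ▸ ⟨by simpa using mul_pos (inv_pos.2 hr0) hv'.1, ?_⟩
    have : mink (r⁻¹ • v) (r⁻¹ • v) = r⁻¹ ^ 2 * mink v v := by
      simp [mink]; ring
    rw [this]
    exact mul_pos (by positivity) hv'.2
  have := hc h1 h2 (sub_nonneg.2 hr1.le) hr0.le (by ring)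
  rwa [smul_smul, smul_smul, mul_inv_cancel₀ (by linarith), mul_inv_cancel₀ hr0.ne', one_smul,
    one_smul] at this

/-- The vectors `b` and `c` have vanishing time component, and their spatial parts complete the
unit vector `e` to an orthonormal basis of `ℝ³`. -/
structure IsTransverseFrame (e : EuclideanSpace ℝ (Fin 3)) (b c : Fin 4 → ℝ) : Prop where
  b_zero : b 0 = 0
  c_zero : c 0 = 0
  mink_b : mink (lightOne e) b = 0
  mink_c : mink (lightOne e) c = 0
  mink_b_self : mink b b = -1
  mink_c_self : mink c c = -1
  mink_b_c : mink b c = 0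
  complete : ∀ i j : Fin 3, e i * e j + b i.succ * b j.succ + c i.succ * c j.succ =
    if i = j then 1 else 0

theorem exists_isTransverseFrame {e : EuclideanSpace ℝ (Fin 3)} (he : ‖e‖ = 1) :
    ∃ b c, IsTransverseFrame e b c := by
  obtain ⟨v, hv⟩ := Orthonormal.exists_orthonormalBasis_extension_of_card_eq (𝕜 := ℝ)
    (E := EuclideanSpace ℝ (Fin 3)) (ι := Fin 3) (by simp) (v := fun _ => e) (s := {0})
    ⟨by simpa using he, fun i j hij => absurd (Subsingleton.elim i j) hij⟩
  have hv0 : v 0 = e := hv 0 rfl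
  have horth : ∀ i j, v i 0 * v j 0 + v i 1 * v j 1 + v i 2 * v j 2 = if i = j then 1 else 0 := by
    intro i j
    have := orthonormal_iff_ite.1 v.orthonormal i j
    rw [PiLp.inner_apply] at this
    simp only [Fin.sum_univ_three, RCLike.inner_apply, conj_trivial] at this
    rw [← this]; ring
  let M : Matrix (Fin 3) (Fin 3) ℝ := Matrix.of fun i j => v i j
  have hM : M * M.transpose = 1 := by
    ext i j
    simp [Matrix.mul_apply, Fin.sum_univ_three, M, horth, Matrix.one_apply]
  have hM' := mul_eq_one_comm.1 hM
  refine ⟨Fin.cons 0 (fun i => v 1 i), Fin.cons 0 (fun i => v 2 i), rfl, rfl, ?_, ?_, ?_, ?_, ?_,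
    ?_⟩
  · have := horth 0 1
    rw [hv0] at this
    simp only [lightOne, mink_cons_cons]
    simp at this ⊢; linarith
  · have := horth 0 2
    rw [hv0] at this
    simp only [lightOne, mink_cons_cons]
    simp at this ⊢; linarith
  · have := horth 1 1
    simp only [mink_cons_cons]
    simp at this ⊢; linarith
  · have := horth 2 2
    simp only [mink_cons_cons]
    simp at this ⊢; linarith
  · have := horth 1 2
    simp only [mink_cons_cons]
    simp at this ⊢; linarith
  · intro i j
    have := congrFun (congrFun hM' i) j
    simp only [Matrix.mul_apply, Fin.sum_univ_three, M, Matrix.transpose_apply, Matrix.of_apply,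
      hv0, Matrix.one_apply] at this
    simpa using this

theorem lightOne_zero (e : EuclideanSpace ℝ (Fin 3)) : lightOne e 0 = 1 := rfl

theorem lightOne_one (e : EuclideanSpace ℝ (Fin 3)) : lightOne e 1 = e 0 := rfl

theorem lightOne_two (e : EuclideanSpace ℝ (Fin 3)) : lightOne e 2 = e 1 := rfl

theorem lightOne_three (e : EuclideanSpace ℝ (Fin 3)) : lightOne e 3 = e 2 := rfl

theorem IsTransverseFrame.exists_add_mem {e : EuclideanSpace ℝ (Fin 3)} (he : ‖e‖ = 1)
    {b c : Fin 4 → ℝ} (hf : IsTransverseFrame e b c) {O : Set (Fin 4 → ℝ)} (hO : IsOpen O)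
    (hc : Convex ℝ O) (hV : Vplus ⊆ O) {x : Fin 4 → ℝ} (hx : x ∈ O) :
    ∃ K : ℝ, 0 < K ∧ ∀ y z s : ℝ, K * (y ^ 2 + z ^ 2) < s →
      x + (y • b + z • c) + s • lightOne e ∈ O := by
  have hev : ∀ᶠ η : ℝ in nhds 0, x - η • lightOne (-e) ∈ O := by
    have : ContinuousAt (fun η : ℝ => x - η • lightOne (-e)) 0 := by fun_prop
    exact this.eventually_mem (by simpa using hO.mem_nhds hx)
  obtain ⟨δ, hδ, hball⟩ := Metric.eventually_nhds_iff.1 hev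
  obtain ⟨η, hη, hηδ⟩ := exists_between hδ
  have hx' := hball (y := η) (by rwa [Real.dist_eq, sub_zero, abs_of_pos hη])
  refine ⟨(4 * η)⁻¹, by positivity, fun y z s hs => ?_⟩
  have hs0 : 0 < s := lt_of_le_of_lt (by positivity) hs
  have hs' : y ^ 2 + z ^ 2 < 4 * η * s := by
    rwa [inv_mul_lt_iff₀ (by positivity)] at hs
  have hv : η • lightOne (-e) + (y • b + z • c) + s • lightOne e ∈ Vplus := by
    have hn : e 0 ^ 2 + e 1 ^ 2 + e 2 ^ 2 = 1 := by
      have := EuclideanSpace.real_norm_sq_eq e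
      rw [he, Fin.sum_univ_three] at this
      linarith
    have h1 := hf.mink_b
    have h2 := hf.mink_c
    have h3 := hf.mink_b_self
    have h4 := hf.mink_c_self
    have h5 := hf.mink_b_c
    rw [Vplus, Set.mem_ofPred_eq]
    simp only [mink, Pi.add_apply, Pi.smul_apply, smul_eq_mul, lightOne_zero, lightOne_one,
      lightOne_two, lightOne_three, PiLp.neg_apply, hf.b_zero, hf.c_zero] at *
    refine ⟨by linarith, ?_⟩
    refine lt_of_lt_of_eq (sub_pos.2 hs') ?_
    linear_combination (s - η) ^ 2 * hn - 2 * (s - η) * y * h1 - 2 * (s - η) * z * h2 - y ^ 2 * h3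
      - z ^ 2 * h4 - 2 * y * z * h5
  have := add_mem_of_mem_Vplus hO hc hV hx' hv
  convert this using 1
  abel

theorem sum_mul_pd (f : (Fin 4 → ℝ) → ℂ) (p x : Fin 4 → ℝ) :
    ∑ ν, (p ν : ℂ) * pd ν f x = fderiv ℝ f x p := by
  conv_rhs => rw [pi_eq_sum_univ' p, map_sum]
  refine Finset.sum_congr rfl fun ν _ => ?_
  rw [map_smul, Complex.real_smul, pd]

theorem fderiv_fderiv_apply {E : Type*} [NormedAddCommGroup E] [NormedSpace ℝ E] {f : E → ℂ}
    {x : E} (hf : ContDiffAt ℝ 2 f x) (v w : E) :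
    fderiv ℝ (fun y => fderiv ℝ f y v) x w = fderiv ℝ (fderiv ℝ f) x w v := by
  have hd : DifferentiableAt ℝ (fderiv ℝ f) x :=
    (hf.fderiv_right (m := 1) (by norm_num)).differentiableAt one_ne_zero
  rw [fderiv_clm_apply hd (by fun_prop)]
  simp

theorem fderiv_fderiv_comp_const_add {E E' : Type*} [NormedAddCommGroup E] [NormedSpace ℝ E]
    [NormedAddCommGroup E'] [NormedSpace ℝ E'] {f : E' → ℂ} (A : E →L[ℝ] E') (y : E') {z : E}
    (hf : ContDiffAt ℝ 2 f (y + A z)) (v w : E) :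
    fderiv ℝ (fderiv ℝ fun z => f (y + A z)) z v w =
      fderiv ℝ (fderiv ℝ f) (y + A z) (A v) (A w) := by
  have hA : ∀ z, HasFDerivAt (fun z => y + A z) A z := fun z => A.hasFDerivAt.const_add y
  have hev : ∀ᶠ z' in nhds z, ContDiffAt ℝ 2 f (y + A z') :=
    (hA z).continuousAt.eventually (hf.eventually (by simp))
  have hfd : (fun z' => fderiv ℝ (fun z => f (y + A z)) z' w) =ᶠ[nhds z]
      fun z' => fderiv ℝ f (y + A z') (A w) := by
    filter_upwards [hev] with z' hz'
    have := (hz'.differentiableAt two_ne_zero).hasFDerivAt.comp z' (hA z')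
    rw [HasFDerivAt.fderiv (f := fun z => f (y + A z)) this]
    rfl
  have hc : ContDiffAt ℝ 2 (fun z => f (y + A z)) z :=
    hf.comp z (contDiff_const.add A.contDiff).contDiffAt
  rw [← fderiv_fderiv_apply hc, hfd.fderiv_eq, ← fderiv_fderiv_apply hf]
  have hd : DifferentiableAt ℝ (fun y => fderiv ℝ f y (A w)) (y + A z) :=
    ((hf.fderiv_right (m := 1) (by norm_num)).differentiableAt one_ne_zero).clm_apply
      (differentiableAt_const _)
  have := hd.hasFDerivAt.comp z (hA z)
  rw [HasFDerivAt.fderiv (f := fun z => fderiv ℝ f (y + A z) (A w)) this]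
  rfl

theorem IsTransverseFrame.fderiv_fderiv_add_eq_zero {e : EuclideanSpace ℝ (Fin 3)}
    {b c : Fin 4 → ℝ} (hf : IsTransverseFrame e b c) {O : Set (Fin 4 → ℝ)} (hO : IsOpen O)
    {f : (Fin 4 → ℝ) → ℂ} (hfO : ContDiffOn ℝ 2 f O)
    (htr : ∀ x ∈ O, fderiv ℝ f x (lightOne e) = 0) (hbox : ∀ x ∈ O, box f x = 0)
    {x : Fin 4 → ℝ} (hx : x ∈ O) :
    fderiv ℝ (fderiv ℝ f) x b b + fderiv ℝ (fderiv ℝ f) x c c = 0 := by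
  set D := fderiv ℝ (fderiv ℝ f) x with hD
  have hsymm : ∀ v w, D v w = D w v := by
    have := (hfO.contDiffAt (hO.mem_nhds hx)).isSymmSndFDerivAt
      (by simp)
    exact fun v w => this v w
  have hDe : ∀ v, D v (lightOne e) = 0 := by
    intro v
    rw [hD, ← fderiv_fderiv_apply (hfO.contDiffAt (hO.mem_nhds hx))]
    have : (fun y => fderiv ℝ f y (lightOne e)) =ᶠ[nhds x] fun _ => 0 := by
      filter_upwards [hO.mem_nhds hx] with y hy using htr y hy
    rw [this.fderiv_eq]
    simp
  have hb : D (Pi.single 0 1) (Pi.single 0 1) - D (Pi.single 1 1) (Pi.single 1 1)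
      - D (Pi.single 2 1) (Pi.single 2 1) - D (Pi.single 3 1) (Pi.single 3 1) = 0 := by
    simp only [hD, ← fderiv_fderiv_apply (hfO.contDiffAt (hO.mem_nhds hx))]
    exact hbox x hx
  have hlin : ∀ u v : Fin 4 → ℝ, D u v =
      ∑ i, ∑ j, (u i : ℂ) * v j * D (Pi.single i 1) (Pi.single j 1) := by
    intro u v
    conv_lhs => rw [pi_eq_sum_univ' u, pi_eq_sum_univ' v]
    simp only [map_sum, map_smul, sum_apply, smul_apply,
      Complex.real_smul, Finset.mul_sum]
    rw [Finset.sum_comm]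
    refine Finset.sum_congr rfl fun i _ => Finset.sum_congr rfl fun j _ => ?_
    ring
  have hDe' : ∀ i : Fin 4, D (Pi.single i 1) (Pi.single 0 1)
      + e 0 * D (Pi.single i 1) (Pi.single 1 1)
      + e 1 * D (Pi.single i 1) (Pi.single 2 1) + e 2 * D (Pi.single i 1) (Pi.single 3 1) = 0 := by
    intro i
    have := hDe (Pi.single i 1)
    rw [pi_eq_sum_univ' (lightOne e)] at this
    simpa only [map_sum, map_smul, Fin.sum_univ_four, Complex.real_smul, lightOne_zero,
      lightOne_one, lightOne_two, lightOne_three, map_add, Complex.ofReal_one, one_mul] using this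
  have hcomp : ∀ i j : Fin 3, (e i * e j + b i.succ * b j.succ + c i.succ * c j.succ : ℂ) =
      if i = j then 1 else 0 := by
    intro i j
    have := congrArg Complex.ofReal (hf.complete i j)
    push_cast [apply_ite Complex.ofReal] at this
    exact this
  rw [hlin b b, hlin c c]
  simp only [Fin.sum_univ_four, hf.b_zero, hf.c_zero]
  have c00 := hcomp 0 0
  have c01 := hcomp 0 1
  have c02 := hcomp 0 2
  have c11 := hcomp 1 1
  have c12 := hcomp 1 2
  have c22 := hcomp 2 2
  simp only [Fin.isValue, Fin.succ_zero_eq_one, Fin.succ_one_eq_two, if_true,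
    show (2 : Fin 3).succ = 3 from rfl, show ((0 : Fin 3) = 1) = False by decide,
    show ((0 : Fin 3) = 2) = False by decide, show ((1 : Fin 3) = 2) = False by decide,
    if_false] at c00 c01 c02 c11 c12 c22
  have s01 := hsymm (Pi.single 0 1) (Pi.single 1 1)
  have s02 := hsymm (Pi.single 0 1) (Pi.single 2 1)
  have s03 := hsymm (Pi.single 0 1) (Pi.single 3 1)
  have s12 := hsymm (Pi.single 1 1) (Pi.single 2 1)
  have s13 := hsymm (Pi.single 1 1) (Pi.single 3 1)
  have s23 := hsymm (Pi.single 2 1) (Pi.single 3 1)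
  have e0 := hDe' 0
  have e1 := hDe' 1
  have e2 := hDe' 2
  have e3 := hDe' 3
  rw [← s01, ← s02, ← s03, ← s12, ← s13, ← s23]
  rw [← s01] at e1
  rw [← s02, ← s12] at e2
  rw [← s03, ← s13, ← s23] at e3
  push_cast
  linear_combination D (Pi.single 1 1) (Pi.single 1 1) * c00
    + D (Pi.single 2 1) (Pi.single 2 1) * c11
    + D (Pi.single 3 1) (Pi.single 3 1) * c22 + 2 * D (Pi.single 1 1) (Pi.single 2 1) * c01
    + 2 * D (Pi.single 1 1) (Pi.single 3 1) * c02 + 2 * D (Pi.single 2 1) (Pi.single 3 1) * c12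
    - (e 0 : ℂ) * e1 - (e 1 : ℂ) * e2 - (e 2 : ℂ) * e3 + e0 - hb

theorem eq_add_smul_of_fderiv_eq_zero {O : Set (Fin 4 → ℝ)} (hO : IsOpen O) (hc : Convex ℝ O)
    {f : (Fin 4 → ℝ) → ℂ} (hf : DifferentiableOn ℝ f O) {p : Fin 4 → ℝ}
    (htr : ∀ x ∈ O, fderiv ℝ f x p = 0) {x : Fin 4 → ℝ} {s t : ℝ} (hs : x + s • p ∈ O)
    (ht : x + t • p ∈ O) : f (x + s • p) = f (x + t • p) := by
  have hder : ∀ r ∈ (fun r : ℝ => x + r • p) ⁻¹' O,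
      HasDerivAt (fun r : ℝ => f (x + r • p)) 0 r := by
    intro r hr
    have h1 : HasDerivAt (fun r : ℝ => x + r • p) p r := by
      simpa using ((hasDerivAt_id r).smul_const p).const_add x
    have := (hf.differentiableAt (hO.mem_nhds hr)).hasFDerivAt.comp_hasDerivAt r h1
    rwa [htr _ hr] at this
  refine (hO.preimage (by fun_prop)).is_const_of_deriv_eq_zero (𝕜 := ℝ)
    (f := fun r : ℝ => f (x + r • p)) ?_
    (fun r hr => (hder r hr).differentiableAt.differentiableWithinAt)
    (fun r hr => (hder r hr).deriv) hs ht
  have : Convex ℝ ((AffineMap.lineMap x (x + p) : ℝ →ᵃ[ℝ] (Fin 4 → ℝ)) ⁻¹' O) :=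
    hc.affine_preimage _
  convert this.isPreconnected using 3 with r
  simp [AffineMap.lineMap_apply, add_comm]

theorem IsTransverseFrame.harmonicAt {e : EuclideanSpace ℝ (Fin 3)}
    {b c : Fin 4 → ℝ} (hf : IsTransverseFrame e b c) {O : Set (Fin 4 → ℝ)} (hO : IsOpen O)
    {f : (Fin 4 → ℝ) → ℂ} (hfO : ContDiffOn ℝ 2 f O)
    (htr : ∀ x ∈ O, fderiv ℝ f x (lightOne e) = 0) (hbox : ∀ x ∈ O, box f x = 0)
    (y : Fin 4 → ℝ) {z : ℂ} (hz : y + (z.re • b + z.im • c) ∈ O) :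
    InnerProductSpace.HarmonicAt (fun z : ℂ => f (y + (z.re • b + z.im • c))) z := by
  let A : ℂ →L[ℝ] (Fin 4 → ℝ) := Complex.reCLM.smulRight b + Complex.imCLM.smulRight c
  have hA : ∀ z : ℂ, A z = z.re • b + z.im • c := fun z => by simp [A]
  simp only [← hA] at hz ⊢
  have hcA : Continuous fun z => y + A z := by fun_prop
  refine ⟨(hfO.contDiffAt (hO.mem_nhds hz)).comp z (contDiff_const.add A.contDiff).contDiffAt, ?_⟩
  filter_upwards [(hO.preimage hcA).mem_nhds hz] with w hw
  have hw' := hfO.contDiffAt (hO.mem_nhds hw)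
  rw [InnerProductSpace.laplacian_eq_iteratedFDeriv_complexPlane]
  simp only [iteratedFDeriv_two_apply, Matrix.cons_val_zero, Matrix.cons_val_one]
  rw [fderiv_fderiv_comp_const_add A y hw', fderiv_fderiv_comp_const_add A y hw']
  simpa [hA] using hf.fderiv_fderiv_add_eq_zero hO hfO htr hbox hw

theorem IsTransverseFrame.exists_eq_add {e : EuclideanSpace ℝ (Fin 3)}
    {b c : Fin 4 → ℝ} (hf : IsTransverseFrame e b c) {x x' : Fin 4 → ℝ}
    (h : mink (lightOne e) x = mink (lightOne e) x') :
    ∃ y z s : ℝ, x' = x + (y • b + z • c) + s • lightOne e := by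
  refine ⟨∑ j : Fin 3, b j.succ * (x' - x) j.succ, ∑ j : Fin 3, c j.succ * (x' - x) j.succ,
    (x' - x) 0, funext fun i => ?_⟩
  have hd : (x' - x) 0 = ∑ j : Fin 3, e j * (x' - x) j.succ := by
    simp only [mink, lightOne_zero, lightOne_one, lightOne_two, lightOne_three] at h
    simp only [Fin.sum_univ_three, Pi.sub_apply, Fin.succ_zero_eq_one, Fin.succ_one_eq_two,
      show (2 : Fin 3).succ = 3 from rfl]
    linarith
  refine Fin.cases ?_ (fun k => ?_) i
  · simp [hf.b_zero, hf.c_zero, lightOne_zero]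
  · have hk : (x' - x) k.succ = ∑ j : Fin 3,
        (e k * e j + b k.succ * b j.succ + c k.succ * c j.succ) * (x' - x) j.succ := by
      simp [hf.complete]
    have he : lightOne e k.succ = e k := rfl
    simp only [Pi.add_apply, Pi.smul_apply, smul_eq_mul, he]
    rw [hd]
    simp only [add_mul, Finset.sum_add_distrib, mul_assoc, ← Finset.mul_sum] at hk
    have hsub : (x' - x) k.succ = x' k.succ - x k.succ := rfl
    linear_combination hk - hsub

theorem apply_eq_of_mink_eq {e : EuclideanSpace ℝ (Fin 3)} (he : ‖e‖ = 1) {O : Set (Fin 4 → ℝ)}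
    (hO : IsOpen O) (hc : Convex ℝ O) (hV : Vplus ⊆ O)
    {f : (Fin 4 → ℝ) → ℂ} (hfO : ContDiffOn ℝ 2 f O)
    (htr : ∀ x ∈ O, fderiv ℝ f x (lightOne e) = 0) (hbox : ∀ x ∈ O, box f x = 0)
    {C : ℝ} (hC : ∀ x, ‖f x‖ ≤ C) {x x' : Fin 4 → ℝ} (hx : x ∈ O) (hx' : x' ∈ O)
    (hxx' : mink (lightOne e) x = mink (lightOne e) x') : f x = f x' := by
  obtain ⟨b, c, hf⟩ := exists_isTransverseFrame he
  obtain ⟨K, hK, hmem⟩ := hf.exists_add_mem he hO hc hV hx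
  obtain ⟨K', hK', hmem'⟩ := hf.exists_add_mem he hO hc hV hx'
  have hline := fun {x : Fin 4 → ℝ} {s t : ℝ} => eq_add_smul_of_fderiv_eq_zero (x := x) (s := s)
    (t := t) hO hc (hfO.differentiableOn two_ne_zero) htr
  let g : ℂ → ℂ := fun z =>
    f (x + (z.re • b + z.im • c) + (K * (z.re ^ 2 + z.im ^ 2) + 1) • lightOne e)
  have hg : ∀ z s, K * (z.re ^ 2 + z.im ^ 2) < s →
      g z = f (x + (z.re • b + z.im • c) + s • lightOne e) := fun z s hs =>
    hline (hmem _ _ _ (by linarith)) (hmem _ _ _ hs)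
  have hharm : InnerProductSpace.HarmonicOnNhd g Set.univ := by
    intro z _
    set S := K * (z.re ^ 2 + z.im ^ 2) + 1 with hS
    have hcont : Continuous fun w : ℂ => K * (w.re ^ 2 + w.im ^ 2) := by fun_prop
    have hev : g =ᶠ[nhds z] fun w => f (x + S • lightOne e + (w.re • b + w.im • c)) := by
      filter_upwards [hcont.continuousAt.eventually_lt_const (show _ < S by linarith)] with w hw
      rw [hg w S hw, add_right_comm]
    rw [InnerProductSpace.harmonicAt_congr_nhds hev]
    refine hf.harmonicAt hO hfO htr hbox _ ?_
    rw [add_right_comm]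
    exact hmem _ _ _ (by linarith)
  have hbdd : Bornology.IsBounded (Set.range g) := by
    rw [isBounded_iff_forall_norm_le]
    exact ⟨C, by rintro _ ⟨z, rfl⟩; exact hC _⟩
  have hconst := InnerProductSpace.bounded_harmonic_on_complex_plane_is_constant g hharm hbdd
  obtain ⟨y, z, s, hd⟩ := hf.exists_eq_add hxx'
  have h0 : f x = g 0 := by
    have h1 := hmem 0 0 1 (by simp)
    rw [hg 0 1 (by simp)]
    simpa using hline (x := x) (s := 0) (t := 1) (by simpa using hx) (by simpa using h1)
  have h1 : f x' = g ⟨y, z⟩ := by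
    set S := max 1 (K * (y ^ 2 + z ^ 2) + 1 - s)
    have hS : 1 ≤ S := le_max_left _ _
    have hS' : K * (y ^ 2 + z ^ 2) + 1 - s ≤ S := le_max_right _ _
    have h1 := hmem' 0 0 S (by simp; linarith)
    rw [hg ⟨y, z⟩ (s + S) (by simp only; linarith), add_smul, ← add_assoc, ← hd]
    simpa using hline (x := x') (s := 0) (t := S) (by simpa using hx') (by simpa using h1)
  rw [h0, h1]
  exact hconst _ _

theorem continuous_mink_right (p : Fin 4 → ℝ) : Continuous (mink p) := by
  unfold mink
  fun_prop

theorem mink_comm (x y : Fin 4 → ℝ) : mink x y = mink y x := by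
  simp only [mink]; ring

theorem mink_smul_left (t : ℝ) (x y : Fin 4 → ℝ) : mink (t • x) y = t * mink x y := by
  simp [mink]; ring

theorem mink_add_left (x y z : Fin 4 → ℝ) : mink (x + y) z = mink x z + mink y z := by
  simp [mink]; ring

theorem mink_smul_right (t : ℝ) (x y : Fin 4 → ℝ) : mink x (t • y) = t * mink x y := by
  simp [mink]; ring

theorem mink_add_right (x y z : Fin 4 → ℝ) : mink x (y + z) = mink x y + mink x z := by
  simp [mink]; ring

theorem integral_mink_pow_eq_of_forall_pos {μ ν : Measure (Fin 4 → ℝ)} [IsProbabilityMeasure μ]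
    [IsProbabilityMeasure ν] {p : Fin 4 → ℝ}
    (h : ∀ t : ℝ, 0 < t →
      ∫ β, Complex.exp (Complex.I * ((mink β (t • p) : ℝ) : ℂ)) ∂μ =
        ∫ β, Complex.exp (Complex.I * ((mink β (t • p) : ℝ) : ℂ)) ∂ν) (m : ℕ) :
    ∫ β, mink p β ^ m ∂μ = ∫ β, mink p β ^ m ∂ν := by
  have hm : Measurable (mink p) := (continuous_mink_right p).measurable
  have : IsProbabilityMeasure (μ.map (mink p)) := Measure.isProbabilityMeasure_map hm.aemeasurable
  have : IsProbabilityMeasure (ν.map (mink p)) := Measure.isProbabilityMeasure_map hm.aemeasurable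
  have hchar : ∀ (κ : Measure (Fin 4 → ℝ)) (t : ℝ), charFun (κ.map (mink p)) t =
      ∫ β, Complex.exp (Complex.I * ((mink β (t • p) : ℝ) : ℂ)) ∂κ := by
    intro κ t
    rw [charFun_apply_real, integral_map hm.aemeasurable (by fun_prop)]
    refine integral_congr_ae (.of_forall fun β => ?_)
    simp only [mink_comm β, mink_smul_left]
    push_cast
    ring_nf
  have hpos : ∀ t : ℝ, 0 < t → charFun (μ.map (mink p)) t = charFun (ν.map (mink p)) t :=
    fun t ht => by rw [hchar, hchar, h t ht]
  have hmap : μ.map (mink p) = ν.map (mink p) := by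
    refine Measure.ext_of_charFun (funext fun t => ?_)
    rcases lt_trichotomy t 0 with ht | rfl | ht
    · rw [← neg_neg t, charFun_neg, charFun_neg (-t), hpos _ (neg_pos.2 ht)]
    · simp
    · exact hpos t ht
  have hpow : ∀ κ : Measure (Fin 4 → ℝ), ∫ β, mink p β ^ m ∂κ = ∫ r, r ^ m ∂κ.map (mink p) :=
    fun κ => (integral_map (f := fun r : ℝ => r ^ m) hm.aemeasurable (by fun_prop)).symm
  rw [hpow, hpow, hmap]

theorem integrable_mink_pow {μ : Measure (Fin 4 → ℝ)} [IsFiniteMeasure μ] {B : Set (Fin 4 → ℝ)}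
    (hB : IsCompact B) (hμ : μ Bᶜ = 0) (p : Fin 4 → ℝ) (m : ℕ) :
    Integrable (fun β => mink p β ^ m) μ := by
  rw [← Measure.restrict_eq_self_of_ae_mem (mem_ae_iff.2 hμ)]
  exact ((continuous_mink_right p).pow m).continuousOn.integrableOn_compact hB

theorem PosLightlike.exists_eq_smul_lightOne {p : Fin 4 → ℝ} (hp : PosLightlike p) :
    ∃ e : EuclideanSpace ℝ (Fin 3), ‖e‖ = 1 ∧ p = p 0 • lightOne e := by
  obtain ⟨-, hpp, hp0⟩ := hp
  refine ⟨WithLp.toLp 2 fun i => p i.succ / p 0, ?_, ?_⟩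
  · rw [← sq_eq_sq₀ (norm_nonneg _) zero_le_one, EuclideanSpace.real_norm_sq_eq]
    simp only [Fin.sum_univ_three, div_pow, one_pow, ← add_div]
    rw [div_eq_one_iff_eq (by positivity)]
    simp only [mink] at hpp
    simp only [Fin.succ_zero_eq_one, Fin.succ_one_eq_two, show (2 : Fin 3).succ = 3 from rfl]
    linarith
  · funext i
    refine Fin.cases ?_ (fun k => ?_) i
    · simp [lightOne_zero]
    · simp [lightOne, mul_div_cancel₀ _ hp0.ne']

theorem posLightlike_smul_lightOne {e : EuclideanSpace ℝ (Fin 3)} (he : ‖e‖ = 1) {t : ℝ}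
    (ht : 0 < t) : PosLightlike (t • lightOne e) := by
  have h0 : (t • lightOne e) 0 = t := by simp [lightOne_zero]
  refine ⟨fun h => ht.ne' (by rw [← h0, h]; rfl), ?_, by rwa [h0]⟩
  have := EuclideanSpace.real_norm_sq_eq e
  rw [he, Fin.sum_univ_three] at this
  simp only [mink, Pi.smul_apply, smul_eq_mul, lightOne_zero, lightOne_one, lightOne_two,
    lightOne_three]
  linear_combination t ^ 2 * this

theorem integral_mink_quadratic_pow_eq_sum {μ : Measure (Fin 4 → ℝ)} [IsFiniteMeasure μ]
    {B : Set (Fin 4 → ℝ)} (hB : IsCompact B) (hμ : μ Bᶜ = 0) (u v w : Fin 4 → ℝ) (m : ℕ) (t : ℝ) :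
    ∫ β, mink (u + (2 * t) • v + t ^ 2 • w) β ^ m ∂μ =
      ∑ i ∈ Finset.range (2 * m + 1),
        (Lagrange.basis (Finset.range (2 * m + 1)) (fun i : ℕ => (i : ℝ)) i).eval t *
          ∫ β, mink (u + (2 * (i : ℝ)) • v + (i : ℝ) ^ 2 • w) β ^ m ∂μ := by
  have hpt : ∀ β, mink (u + (2 * t) • v + t ^ 2 • w) β ^ m =
      ∑ i ∈ Finset.range (2 * m + 1),
        (Lagrange.basis (Finset.range (2 * m + 1)) (fun i : ℕ => (i : ℝ)) i).eval t *
          mink (u + (2 * (i : ℝ)) • v + (i : ℝ) ^ 2 • w) β ^ m := by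
    intro β
    let q : Polynomial ℝ := (Polynomial.C (mink w β) * Polynomial.X ^ 2 +
      Polynomial.C (2 * mink v β) * Polynomial.X + Polynomial.C (mink u β)) ^ m
    have hq : ∀ s : ℝ, q.eval s = mink (u + (2 * s) • v + s ^ 2 • w) β ^ m := by
      intro s
      simp only [q, mink_add_left, mink_smul_left, Polynomial.eval_pow, Polynomial.eval_add,
        Polynomial.eval_mul, Polynomial.eval_C, Polynomial.eval_X]
      ring
    have hdeg : q.degree < (Finset.range (2 * m + 1)).card := by
      rw [Finset.card_range]
      refine (Polynomial.degree_le_natDegree).trans_lt ?_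
      have h2 : q.natDegree ≤ m * 2 :=
        Polynomial.natDegree_pow_le_of_le m Polynomial.natDegree_quadratic_le
      exact_mod_cast (by omega : q.natDegree < 2 * m + 1)
    have hinj : Set.InjOn (fun i : ℕ => (i : ℝ)) (Finset.range (2 * m + 1)) :=
      Nat.cast_injective.injOn
    have := congrArg (Polynomial.eval t) (Lagrange.eq_interpolate hinj hdeg)
    rw [hq, Lagrange.interpolate_apply, Polynomial.eval_finsetSum] at this
    rw [this]
    refine Finset.sum_congr rfl fun i _ => ?_
    rw [Polynomial.eval_mul, Polynomial.eval_C, hq, mul_comm]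
  simp_rw [hpt]
  rw [integral_finsetSum]
  · simp_rw [integral_const_mul]
  · exact fun i _ => (integrable_mink_pow hB hμ _ m).const_mul _

theorem IsTransverseFrame.mink_quadratic {e : EuclideanSpace ℝ (Fin 3)} (he : ‖e‖ = 1)
    {b c : Fin 4 → ℝ} (hf : IsTransverseFrame e b c) (t : ℝ) :
    PosLightlike (lightOne e + (2 * t) • b + t ^ 2 • lightOne (-e)) ∧
      mink (lightOne e + (2 * t) • b + t ^ 2 • lightOne (-e)) (lightOne e) = 2 * t ^ 2 ∧
      mink (lightOne e + (2 * t) • b + t ^ 2 • lightOne (-e)) (lightOne (-e)) = 2 := by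
  have hn := EuclideanSpace.real_norm_sq_eq e
  rw [he, Fin.sum_univ_three] at hn
  have h0 : (lightOne e + (2 * t) • b + t ^ 2 • lightOne (-e)) 0 = 1 + t ^ 2 := by
    simp [lightOne_zero, hf.b_zero]
  have hpos : 0 < 1 + t ^ 2 := by positivity
  have h1 := hf.mink_b
  have h3 := hf.mink_b_self
  refine ⟨⟨fun h => hpos.ne' (by rw [← h0, h]; rfl), ?_, by rwa [h0]⟩, ?_, ?_⟩
  all_goals
    simp only [mink, Pi.add_apply, Pi.smul_apply, smul_eq_mul, lightOne_zero, lightOne_one,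
      lightOne_two, lightOne_three, PiLp.neg_apply, hf.b_zero] at *
  · linear_combination (1 - t ^ 2) ^ 2 * hn + 4 * t ^ 2 * h3 + 4 * t * (1 - t ^ 2) * h1
  · linear_combination (1 - t ^ 2) * hn + 2 * t * h1
  · linear_combination (t ^ 2 - 1) * hn - 2 * t * h1

theorem eq_zero_of_eval_eq_pow_mul {P₀ P₁ : Polynomial ℝ} {d : ℕ} (hd : P₀.natDegree < d)
    (h : ∀ t, P₀.eval t = t ^ d * P₁.eval t) : P₁ = 0 := by
  have hP : P₀ = Polynomial.X ^ d * P₁ := Polynomial.funext fun t => by simp [h]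
  by_contra hne
  rw [hP, Polynomial.natDegree_X_pow_mul _ hne] at hd
  omega

theorem iteratedDeriv_integral_mink_pow_eq_zero {O : Set (Fin 4 → ℝ)} (hO : IsOpen O)
    {B : Set (Fin 4 → ℝ)} (hB : IsCompact B) {ρ : (Fin 4 → ℝ) → Measure (Fin 4 → ℝ)}
    (hprob : ∀ x, IsProbabilityMeasure (ρ x)) (hsupp : ∀ x, ρ x Bᶜ = 0) {m : ℕ}
    (hsmooth : ∀ p, PosLightlike p →
      ContDiffOn ℝ (⊤ : ℕ∞) (fun x => ∫ β, mink p β ^ m ∂ρ x) O)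
    (hinv : ∀ p, PosLightlike p → ∀ x ∈ O, ∀ x' ∈ O, mink p x = mink p x' →
      ∫ β, mink p β ^ m ∂ρ x = ∫ β, mink p β ^ m ∂ρ x')
    {e : EuclideanSpace ℝ (Fin 3)} (he : ‖e‖ = 1) {x : Fin 4 → ℝ} (hx : x ∈ O) :
    iteratedDeriv (m + 1)
      (fun s : ℝ => ∫ β, mink (lightOne e) β ^ m ∂ρ (x + s • lightOne (-e))) 0 = 0 := by
  obtain ⟨b, c, hf⟩ := exists_isTransverseFrame he
  let p : ℝ → Fin 4 → ℝ := fun t => lightOne e + (2 * t) • b + t ^ 2 • lightOne (-e)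
  have hp : ∀ t, PosLightlike (p t) := fun t => (hf.mink_quadratic he t).1
  let D : (Fin 4 → ℝ) → ℝ → ℝ := fun v t =>
    iteratedDeriv (m + 1) (fun s : ℝ => ∫ β, mink (p t) β ^ m ∂ρ (x + s • v)) 0
  let P : (Fin 4 → ℝ) → Polynomial ℝ := fun v => ∑ i ∈ Finset.range (2 * m + 1),
    Lagrange.basis (Finset.range (2 * m + 1)) (fun i : ℕ => (i : ℝ)) i * Polynomial.C (D v i)
  have hmem : ∀ v, ∀ᶠ s : ℝ in nhds 0, x + s • v ∈ O := fun v =>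
    (show ContinuousAt (fun s : ℝ => x + s • v) 0 by fun_prop).eventually_mem
      (by simpa using hO.mem_nhds hx)
  have hDP : ∀ v t, D v t = (P v).eval t := by
    intro v t
    have hcd : ∀ i : ℕ, ContDiffAt ℝ (m + 1 : ℕ)
        (fun s : ℝ => ∫ β, mink (p i) β ^ m ∂ρ (x + s • v)) 0 := by
      intro i
      have h1 : ContDiffAt ℝ (m + 1 : ℕ) (fun x => ∫ β, mink (p i) β ^ m ∂ρ x)
          (x + (0 : ℝ) • v) :=
        ((hsmooth _ (hp i)).contDiffAt (hO.mem_nhds (by simpa using hx))).of_le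
          (by exact_mod_cast le_top)
      exact h1.comp (f := fun s : ℝ => x + s • v) (0 : ℝ) (by fun_prop)
    simp only [D, P, p, integral_mink_quadratic_pow_eq_sum hB (hsupp _) (lightOne e) b
      (lightOne (-e)) m t]
    rw [iteratedDeriv_fun_sum fun i _ => contDiffAt_const.mul (hcd i), Polynomial.eval_finsetSum]
    refine Finset.sum_congr rfl fun i _ => ?_
    rw [iteratedDeriv_const_mul_field, Polynomial.eval_mul, Polynomial.eval_C]
  have hrel : ∀ t, D (lightOne e) t = t ^ (2 * (m + 1)) * D (lightOne (-e)) t := by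
    intro t
    have htend : Filter.Tendsto (fun s : ℝ => t ^ 2 * s) (nhds 0) (nhds 0) := by
      have : Continuous fun s : ℝ => t ^ 2 * s := by fun_prop
      simpa using this.tendsto 0
    have hev : (fun s : ℝ => ∫ β, mink (p t) β ^ m ∂ρ (x + s • lightOne e)) =ᶠ[nhds 0]
        fun s => ∫ β, mink (p t) β ^ m ∂ρ (x + (t ^ 2 * s) • lightOne (-e)) := by
      filter_upwards [hmem (lightOne e), htend.eventually (hmem (lightOne (-e)))] with s h1 h2
      refine hinv _ (hp t) _ h1 _ h2 ?_
      simp only [mink_add_right, mink_smul_right, p, (hf.mink_quadratic he t).2.1,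
        (hf.mink_quadratic he t).2.2]
      ring
    simp only [D]
    rw [hev.iteratedDeriv_eq, iteratedDeriv_comp_mul_left_apply (m + 1)
      (fun s => ∫ β, mink (p t) β ^ m ∂ρ (x + s • lightOne (-e))), mul_zero, ← pow_mul,
      smul_eq_mul]
  have hdeg : (P (lightOne e)).natDegree < 2 * (m + 1) := by
    refine lt_of_le_of_lt (Polynomial.natDegree_sum_le_of_forall_le (n := 2 * m) _ _
      fun i hi => ?_) (by omega)
    refine (Polynomial.natDegree_mul_C_le _ _).trans (le_of_eq ?_)
    exact Polynomial.natDegree_eq_of_degree_eq_some (by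
      rw [Lagrange.degree_basis Nat.cast_injective.injOn hi, Finset.card_range,
        Nat.add_sub_cancel])
  have hP : P (lightOne (-e)) = 0 :=
    eq_zero_of_eval_eq_pow_mul hdeg fun t => by rw [← hDP, ← hDP, hrel]
  have h0 := hDP (lightOne (-e)) 0
  simpa [hP, D, p] using h0

theorem exists_polynomial_eval_mink {O : Set (Fin 4 → ℝ)} (hO : IsOpen O) (hc : Convex ℝ O)
    {f : (Fin 4 → ℝ) → ℝ} (hf : ContDiffOn ℝ (⊤ : ℕ∞) f O) {p a : Fin 4 → ℝ} (ha : mink p a ≠ 0)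
    (hinv : ∀ x ∈ O, ∀ x' ∈ O, mink p x = mink p x' → f x = f x') {m : ℕ}
    (hz : ∀ x ∈ O, iteratedDeriv (m + 1) (fun s : ℝ => f (x + s • a)) 0 = 0) :
    ∃ Q : Polynomial ℝ, Q.natDegree ≤ m ∧ ∀ x ∈ O, f x = Q.eval (mink p x) := by
  classical
  let h : ℝ → ℝ := fun u => if hu : ∃ x ∈ O, mink p x = u then f hu.choose else 0
  have hh : ∀ x ∈ O, h (mink p x) = f x := by
    intro x hx
    have hu : ∃ x' ∈ O, mink p x' = mink p x := ⟨x, hx, rfl⟩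
    simp only [h, dif_pos hu]
    exact hinv _ hu.choose_spec.1 _ hx hu.choose_spec.2
  have hmink : ∀ x u, mink p (x + ((mink p a)⁻¹ * (u - mink p x)) • a) = u := by
    intro x u
    rw [mink_add_right, mink_smul_right]
    field_simp
    ring
  have hmem : ∀ x ∈ O, ∀ᶠ u in nhds (mink p x),
      x + ((mink p a)⁻¹ * (u - mink p x)) • a ∈ O := fun x hx =>
    (show ContinuousAt (fun u : ℝ => x + ((mink p a)⁻¹ * (u - mink p x)) • a) (mink p x) by
      fun_prop).eventually_mem (by simpa using hO.mem_nhds hx)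
  have hev : ∀ x ∈ O, h =ᶠ[nhds (mink p x)]
      fun u => f (x + ((mink p a)⁻¹ * (u - mink p x)) • a) := fun x hx => by
    filter_upwards [hmem x hx] with u hu
    rw [← hh _ hu, hmink]
  have hopen : IsOpen (mink p '' O) := by
    refine isOpen_iff_mem_nhds.2 ?_
    rintro _ ⟨x, hx, rfl⟩
    filter_upwards [hmem x hx] with u hu using ⟨_, hu, hmink x u⟩
  have hsmooth : ContDiffOn ℝ (⊤ : ℕ∞) h (mink p '' O) := by
    rintro _ ⟨x, hx, rfl⟩
    refine ContDiffAt.contDiffWithinAt (ContDiffAt.congr_of_eventuallyEq ?_ (hev x hx))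
    have h1 : ContDiffAt ℝ (⊤ : ℕ∞) f (x + ((mink p a)⁻¹ * (mink p x - mink p x)) • a) :=
      hf.contDiffAt (hO.mem_nhds (by simpa using hx))
    exact h1.comp (f := fun u : ℝ => x + ((mink p a)⁻¹ * (u - mink p x)) • a) (mink p x)
      (by fun_prop)
  have hder : ∀ u ∈ mink p '' O, iteratedDeriv (m + 1) h u = 0 := by
    rintro _ ⟨x, hx, rfl⟩
    rw [(hev x hx).iteratedDeriv_eq, iteratedDeriv_comp_sub_const (m + 1)
        (fun u => f (x + ((mink p a)⁻¹ * u) • a)) (mink p x)]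
    simp only [sub_self]
    rw [iteratedDeriv_comp_mul_left_apply (m + 1) (fun s => f (x + s • a)), mul_zero, hz x hx,
      smul_zero]
  obtain ⟨Q, hQ, hQe⟩ := exists_polynomial_of_iteratedDeriv_eq_zero hopen
    (hc.isPreconnected.image _ (continuous_mink_right p).continuousOn) hsmooth hder
  exact ⟨Q, hQ, fun x hx => by rw [← hh x hx, hQe _ ⟨x, hx, rfl⟩]⟩

theorem mink_lightOne_lightOne_neg {e : EuclideanSpace ℝ (Fin 3)} (he : ‖e‖ = 1) :
    mink (lightOne e) (lightOne (-e)) = 2 := by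
  have hn := EuclideanSpace.real_norm_sq_eq e
  rw [he, Fin.sum_univ_three] at hn
  simp only [mink, lightOne_zero, lightOne_one, lightOne_two, lightOne_three, PiLp.neg_apply]
  linear_combination -hn

/-- Moment-polynomial step in the proof of Proposition 5.2: for a family of
thermal reference measures (ρ_x) with compact temperature support B ⊆ V₊
whose lightlike characteristic functions F_p satisfy the transport and wave
equations, each lightlike moment x ↦ ∫ (e·β)^m dρ_x is a polynomial of
degree at most m in e·x. -/
theorem lightlike_moments_are_polynomials
    (O : Set (Fin 4 → ℝ)) (hOopen : IsOpen O) (hOconv : Convex ℝ O)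
    (hOV : Vplus ⊆ O)
    (B : Set (Fin 4 → ℝ)) (hBc : IsCompact B) (hBV : B ⊆ Vplus)
    (ρ : (Fin 4 → ℝ) → Measure (Fin 4 → ℝ))
    (hprob : ∀ x, IsProbabilityMeasure (ρ x))
    (hsupp : ∀ x, ρ x Bᶜ = 0)
    (hFp : ∀ p : Fin 4 → ℝ, PosLightlike p →
      ContDiffOn ℝ (⊤ : ℕ∞)
        (fun x => ∫ β, Complex.exp (Complex.I * ((mink β p : ℝ) : ℂ)) ∂(ρ x)) O ∧
      (∀ x ∈ O, ∑ ν : Fin 4, (p ν : ℂ) *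
        pd ν (fun x' => ∫ β, Complex.exp (Complex.I * ((mink β p : ℝ) : ℂ)) ∂(ρ x')) x
          = 0) ∧
      (∀ x ∈ O,
        box (fun x' => ∫ β, Complex.exp (Complex.I * ((mink β p : ℝ) : ℂ)) ∂(ρ x')) x
          = 0))
    (hmom : ∀ e : EuclideanSpace ℝ (Fin 3), ‖e‖ = 1 → ∀ m : ℕ,
      ContDiffOn ℝ (⊤ : ℕ∞) (fun x => ∫ β, (mink (lightOne e) β) ^ m ∂(ρ x)) O) :
    ∀ e : EuclideanSpace ℝ (Fin 3), ‖e‖ = 1 → ∀ m : ℕ,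
      ∃ Q : Polynomial ℝ, Q.natDegree ≤ m ∧
        ∀ x ∈ O, ∫ β, (mink (lightOne e) β) ^ m ∂(ρ x)
          = Q.eval (mink (lightOne e) x) := by
  intro e he m
  have hscale : ∀ (t : ℝ) (e : EuclideanSpace ℝ (Fin 3)) (x : Fin 4 → ℝ),
      ∫ β, mink (t • lightOne e) β ^ m ∂ρ x = t ^ m * ∫ β, mink (lightOne e) β ^ m ∂ρ x := by
    intro t e x
    simp_rw [mink_smul_left, mul_pow, integral_const_mul]
  have hsmooth : ∀ p, PosLightlike p →
      ContDiffOn ℝ (⊤ : ℕ∞) (fun x => ∫ β, mink p β ^ m ∂ρ x) O := by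
    intro p hp
    obtain ⟨e', he', hpe⟩ := hp.exists_eq_smul_lightOne
    rw [hpe]
    simp_rw [hscale]
    exact contDiffOn_const.mul (hmom e' he' m)
  have hinv : ∀ p, PosLightlike p → ∀ x ∈ O, ∀ x' ∈ O, mink p x = mink p x' →
      ∫ β, mink p β ^ m ∂ρ x = ∫ β, mink p β ^ m ∂ρ x' := by
    intro p hp x hx x' hx' hxx'
    obtain ⟨e', he', hpe⟩ := hp.exists_eq_smul_lightOne
    rw [hpe, mink_smul_left, mink_smul_left] at hxx'
    rw [hpe, hscale, hscale]
    refine congrArg _ (integral_mink_pow_eq_of_forall_pos (fun t ht => ?_) m)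
    obtain ⟨h1, h2, h3⟩ := hFp _ (posLightlike_smul_lightOne he' ht)
    refine apply_eq_of_mink_eq he' hOopen hOconv hOV
      (f := fun x => ∫ β, Complex.exp (Complex.I * ((mink β (t • lightOne e') : ℝ) : ℂ)) ∂ρ x)
      (contDiffOn_infty.1 h1 2) (fun y hy => ?_) h3
      (C := 1) (fun y => ?_) hx hx' (mul_left_cancel₀ hp.2.2.ne' hxx')
    · have := h2 y hy
      rw [sum_mul_pd, map_smul] at this
      exact (smul_eq_zero.1 this).resolve_left ht.ne'
    · have hb := norm_integral_le_of_norm_le_const (μ := ρ y) (C := 1)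
        (f := fun β => Complex.exp (Complex.I * ((mink β (t • lightOne e') : ℝ) : ℂ)))
        (.of_forall fun β => by rw [mul_comm, Complex.norm_exp_ofReal_mul_I])
      simpa using hb
  have hpe : PosLightlike (lightOne e) := by
    simpa using posLightlike_smul_lightOne he one_pos
  exact exists_polynomial_eval_mink hOopen hOconv (hsmooth _ hpe)
    (by rw [mink_lightOne_lightOne_neg he]; exact two_ne_zero) (hinv _ hpe)
    fun x hx => iteratedDeriv_integral_mink_pow_eq_zero hOopen hBc hprob hsupp hsmooth hinv he hx
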